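/- Let d ≥ 1, let ‖·‖ be any norm on ℝ^d with closed unit ball B(0,1), let ω : [0,∞) → [0,∞) be a bounded modulus of continuity (not identically zero), set Ω = sup_{s ≥ 0} ω(s), and define ψ : ℝ^d → ℝ by ψ(x) = Ω − ω(‖x‖). Then for every t > 0 one has ω(ψ, t) = ω(t), and the uncentered maximal function of ψ satisfies the equality ω(Mψ, t) = sup_{v : ‖v‖ = 1} inf_{c ∈ ℝ^d, R > 0 with ‖v − c‖ ≤ R} (1/λ(B(0,1))) ∫_{B(0,1)} ω(t‖c + Ru‖) dλ(u). -/

import Mathlib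

open MeasureTheory Set Filter Topology

/-- The closed ball of the norm-like function `N`, with center `c` and radius `R`. -/
def nball {d : ℕ} (N : (Fin d → ℝ) → ℝ) (c : Fin d → ℝ) (R : ℝ) : Set (Fin d → ℝ) :=
  {y | N (y - c) ≤ R}

/-- The uncentered Hardy–Littlewood maximal function associated to the norm `N`,
with respect to `d`-dimensional Lebesgue measure. -/
noncomputable def maxFn {d : ℕ} (N : (Fin d → ℝ) → ℝ) (f : (Fin d → ℝ) → ℝ)
    (x : Fin d → ℝ) : ℝ :=
  sSup {a : ℝ | ∃ c : Fin d → ℝ, ∃ R : ℝ, 0 < R ∧ x ∈ nball N c R ∧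
    a = ⨍ y in nball N c R, |f y|}

/-- The modulus of continuity of `g`, with distances measured using `N`. -/
noncomputable def modCont {d : ℕ} (N : (Fin d → ℝ) → ℝ) (g : (Fin d → ℝ) → ℝ) (δ : ℝ) : ℝ :=
  sSup {a : ℝ | ∃ x y : Fin d → ℝ, N (x - y) ≤ δ ∧ a = |g x - g y|}

/-- `N` is a norm on `ℝ^d`. -/
structure IsNorm {d : ℕ} (N : (Fin d → ℝ) → ℝ) : Prop where
  eq_zero_iff : ∀ x, N x = 0 ↔ x = 0
  add_le : ∀ x y, N (x + y) ≤ N x + N y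
  smul : ∀ (a : ℝ) (x), N (a • x) = |a| * N x

/-- `ω` is a modulus of continuity: continuous, nondecreasing, subadditive on `[0,∞)`,
vanishing at `0`, nonnegative, and not identically zero. -/
structure IsModulus (ω : ℝ → ℝ) : Prop where
  nonneg : ∀ t, 0 ≤ t → 0 ≤ ω t
  map_zero : ω 0 = 0
  mono : MonotoneOn ω (Ici 0)
  subadd : ∀ a b, 0 ≤ a → 0 ≤ b → ω (a + b) ≤ ω a + ω b
  cont : ContinuousOn ω (Ici 0)
  nontrivial : ∃ t, 0 < t ∧ ω t ≠ 0

/-- The `Lip(ω)` seminorm of `f`: `sup_{t>0} ω(f,t)/ω(t)`. -/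
noncomputable def lipNorm {d : ℕ} (N : (Fin d → ℝ) → ℝ) (ω : ℝ → ℝ)
    (f : (Fin d → ℝ) → ℝ) : ℝ :=
  sSup {a : ℝ | ∃ t : ℝ, 0 < t ∧ a = modCont N f t / ω t}

/-- The operator norm of the uncentered maximal operator on `Lip(ω)`. -/
noncomputable def opNorm (d : ℕ) (N : (Fin d → ℝ) → ℝ) (ω : ℝ → ℝ) : ℝ :=
  sSup {a : ℝ | ∃ f : (Fin d → ℝ) → ℝ, lipNorm N ω f = 1 ∧ a = lipNorm N ω (maxFn N f)}

/-- The Hölder `α` seminorm of `f`, distances measured with `N`. -/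
noncomputable def holderNorm {d : ℕ} (N : (Fin d → ℝ) → ℝ) (α : ℝ)
    (f : (Fin d → ℝ) → ℝ) : ℝ :=
  sSup {a : ℝ | ∃ x y : Fin d → ℝ, x ≠ y ∧ a = |f x - f y| / N (x - y) ^ α}

/-- The operator norm of the uncentered maximal operator on the Hölder class `Lip_α`. -/
noncomputable def opNormHolder (d : ℕ) (N : (Fin d → ℝ) → ℝ) (α : ℝ) : ℝ :=
  sSup {a : ℝ | ∃ f : (Fin d → ℝ) → ℝ, holderNorm N α f = 1 ∧
    a = holderNorm N α (maxFn N f)}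

namespace IsNorm

variable {d : ℕ} {N : (Fin d → ℝ) → ℝ}

lemma map_zero (hN : IsNorm N) : N 0 = 0 := (hN.eq_zero_iff 0).2 rfl

lemma map_neg (hN : IsNorm N) (x : Fin d → ℝ) : N (-x) = N x := by
  simpa using hN.smul (-1) x

lemma nonneg (hN : IsNorm N) (x : Fin d → ℝ) : 0 ≤ N x := by
  have h := hN.add_le x (-x)
  rw [add_neg_cancel, hN.map_zero, hN.map_neg] at h
  linarith

lemma smul_of_nonneg (hN : IsNorm N) {a : ℝ} (ha : 0 ≤ a) (x : Fin d → ℝ) :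
    N (a • x) = a * N x := by
  rw [hN.smul, abs_of_nonneg ha]

lemma sub_comm (hN : IsNorm N) (x y : Fin d → ℝ) : N (x - y) = N (y - x) := by
  rw [← hN.map_neg, neg_sub]

lemma continuous (hN : IsNorm N) : Continuous N := by
  have hconv : ConvexOn ℝ univ N := by
    refine ⟨convex_univ, fun x _ y _ a b ha hb _ => ?_⟩
    refine (hN.add_le _ _).trans_eq ?_
    rw [hN.smul_of_nonneg ha, hN.smul_of_nonneg hb, smul_eq_mul, smul_eq_mul]
  exact hconv.locallyLipschitz.continuous

lemma isClosed_nball (hN : IsNorm N) (c : Fin d → ℝ) (R : ℝ) : IsClosed (nball N c R) :=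
  isClosed_le (hN.continuous.comp (continuous_id.sub continuous_const)) continuous_const

lemma exists_pos_mul_norm_le (hN : IsNorm N) : ∃ m : ℝ, 0 < m ∧ ∀ x, m * ‖x‖ ≤ N x := by
  rcases (Metric.sphere (0 : Fin d → ℝ) 1).eq_empty_or_nonempty with he | hne
  · refine ⟨1, one_pos, fun x => ?_⟩
    have hx : x = 0 := by
      by_contra hx
      have : ‖x‖⁻¹ • x ∈ Metric.sphere (0 : Fin d → ℝ) 1 := by
        simp [norm_smul, norm_ne_zero_iff.2 hx]
      simp [he] at this
    simp [hx, hN.map_zero]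
  · obtain ⟨z, hz, hmin⟩ :=
      (isCompact_sphere (0 : Fin d → ℝ) 1).exists_isMinOn hne hN.continuous.continuousOn
    have hz0 : z ≠ 0 := by
      rintro rfl
      simp at hz
    refine ⟨N z, lt_of_le_of_ne (hN.nonneg z) fun h => hz0 ((hN.eq_zero_iff z).1 h.symm),
      fun x => ?_⟩
    rcases eq_or_ne x 0 with rfl | hx
    · simp [hN.map_zero]
    have hx' : 0 < ‖x‖ := norm_pos_iff.2 hx
    have hmem : ‖x‖⁻¹ • x ∈ Metric.sphere (0 : Fin d → ℝ) 1 := by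
      simp [norm_smul, hx'.ne']
    have h := isMinOn_iff.1 hmin _ hmem
    rw [hN.smul_of_nonneg (inv_nonneg.2 hx'.le), inv_mul_eq_div] at h
    exact (le_div_iff₀ hx').1 h

lemma isCompact_nball (hN : IsNorm N) (c : Fin d → ℝ) (R : ℝ) : IsCompact (nball N c R) := by
  obtain ⟨m, hm, h⟩ := hN.exists_pos_mul_norm_le
  refine (isCompact_closedBall c (R / m)).of_isClosed_subset (hN.isClosed_nball c R) ?_
  intro y hy
  rw [mem_closedBall_iff_norm, le_div_iff₀ hm, mul_comm]
  exact (h _).trans hy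

lemma volume_unitBall_pos (hN : IsNorm N) : 0 < (volume (nball N 0 1)).toReal := by
  refine ENNReal.toReal_pos (ne_of_gt ?_) (hN.isCompact_nball 0 1).measure_lt_top.ne
  have ho : IsOpen {y : Fin d → ℝ | N y < 1} := isOpen_lt hN.continuous continuous_const
  refine (ho.measure_pos volume ⟨0, by simp [hN.map_zero]⟩).trans_le (measure_mono ?_)
  intro y hy
  simpa [nball] using le_of_lt hy

open scoped Pointwise in
lemma setIntegral_nball (hN : IsNorm N) (f : (Fin d → ℝ) → ℝ) (c : Fin d → ℝ) {R : ℝ}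
    (hR : 0 < R) :
    ∫ y in nball N c R, f y = R ^ d * ∫ u in nball N 0 1, f (c + R • u) := by
  have h1 : ∫ y in nball N c R, f y = ∫ y in nball N 0 R, f (c + y) := by
    rw [← (measurePreserving_add_left volume c).setIntegral_preimage_emb
      (measurableEmbedding_addLeft c)]
    congr 2
    ext y
    simp [nball]
  have h2 : R • nball N 0 1 = nball N 0 R := by
    ext y
    rw [mem_smul_set_iff_inv_smul_mem₀ hR.ne']
    simp only [nball, mem_ofPred_eq, sub_zero]
    rw [hN.smul_of_nonneg (inv_nonneg.2 hR.le), inv_mul_le_iff₀ hR, mul_one]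
  rw [Measure.setIntegral_comp_smul_of_pos volume (fun y => f (c + y)) _ hR, h2, h1,
    Module.finrank_fin_fun, smul_eq_mul, mul_inv_cancel_left₀ (pow_pos hR d).ne']

lemma setAverage_nball (hN : IsNorm N) (f : (Fin d → ℝ) → ℝ) (c : Fin d → ℝ) {R : ℝ}
    (hR : 0 < R) :
    ⨍ y in nball N c R, f y =
      (∫ u in nball N 0 1, f (c + R • u)) / (volume (nball N 0 1)).toReal := by
  have hvol := hN.setIntegral_nball (fun _ => 1) c hR
  simp only [setIntegral_const, smul_eq_mul, mul_one, Measure.real] at hvol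
  rw [setAverage_eq, Measure.real, hvol, hN.setIntegral_nball f c hR, smul_eq_mul,
    inv_mul_eq_div, mul_div_mul_left _ _ (pow_pos hR d).ne']

end IsNorm

/-- The average of `ω ∘ N` over the ball of center `c` and radius `R`, written over the
unit ball. -/
noncomputable def ballAvg {d : ℕ} (N : (Fin d → ℝ) → ℝ) (ω : ℝ → ℝ) (c : Fin d → ℝ)
    (R : ℝ) : ℝ :=
  (∫ u in nball N 0 1, ω (N (c + R • u))) / (volume (nball N 0 1)).toReal

/-- The averages of `ω ∘ N` over the balls containing `x`. -/
def avgSet {d : ℕ} (N : (Fin d → ℝ) → ℝ) (ω : ℝ → ℝ) (x : Fin d → ℝ) : Set ℝ :=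
  {b | ∃ c : Fin d → ℝ, ∃ R : ℝ, 0 < R ∧ N (x - c) ≤ R ∧ b = ballAvg N ω c R}

namespace IsModulus

variable {d : ℕ} {N : (Fin d → ℝ) → ℝ} {ω : ℝ → ℝ}

lemma integrableOn_unitBall (hω : IsModulus ω) (hN : IsNorm N) (c : Fin d → ℝ) (R : ℝ) :
    IntegrableOn (fun u => ω (N (c + R • u))) (nball N 0 1) := by
  have hcont : Continuous fun u : Fin d → ℝ => ω (N (c + R • u)) :=
    hω.cont.comp_continuous (hN.continuous.comp (by fun_prop)) fun _ => hN.nonneg _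
  exact hcont.continuousOn.integrableOn_compact (hN.isCompact_nball 0 1)

lemma ballAvg_nonneg (hω : IsModulus ω) (hN : IsNorm N) (c : Fin d → ℝ) (R : ℝ) :
    0 ≤ ballAvg N ω c R :=
  div_nonneg (integral_nonneg fun _ => hω.nonneg _ (hN.nonneg _)) ENNReal.toReal_nonneg

lemma ballAvg_le (hω : IsModulus ω) (hN : IsNorm N) {c : Fin d → ℝ} {R K : ℝ}
    (h : ∀ u ∈ nball N 0 1, ω (N (c + R • u)) ≤ K) : ballAvg N ω c R ≤ K := by
  have hmono := setIntegral_mono_on (hω.integrableOn_unitBall hN c R)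
    (integrableOn_const (C := K) (hN.isCompact_nball 0 1).measure_lt_top.ne)
    (hN.isClosed_nball 0 1).measurableSet h
  rw [setIntegral_const, smul_eq_mul, mul_comm] at hmono
  exact (div_le_iff₀ hN.volume_unitBall_pos).2 hmono

lemma ballAvg_add_le (hω : IsModulus ω) (hN : IsNorm N) (c c' : Fin d → ℝ) (R R' : ℝ) :
    ballAvg N ω (c + c') (R + R') ≤ ballAvg N ω c R + ballAvg N ω c' R' := by
  have hc := hω.integrableOn_unitBall hN c R
  have hc' := hω.integrableOn_unitBall hN c' R'
  rw [ballAvg, ballAvg, ballAvg, ← add_div, ← integral_add hc hc']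
  refine div_le_div_of_nonneg_right (integral_mono (hω.integrableOn_unitBall hN _ _)
    (hc.add hc') fun u => ?_) ENNReal.toReal_nonneg
  have hle : N (c + c' + (R + R') • u) ≤ N (c + R • u) + N (c' + R' • u) := by
    refine le_of_eq_of_le (congrArg N ?_) (hN.add_le _ _)
    rw [add_smul]
    abel
  exact (hω.mono (hN.nonneg _) (add_nonneg (hN.nonneg _) (hN.nonneg _)) hle).trans
    (hω.subadd _ _ (hN.nonneg _) (hN.nonneg _))

lemma bddBelow_avgSet (hω : IsModulus ω) (hN : IsNorm N) (x : Fin d → ℝ) :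
    BddBelow (avgSet N ω x) := by
  refine ⟨0, ?_⟩
  rintro _ ⟨c, R, -, -, rfl⟩
  exact hω.ballAvg_nonneg hN c R

lemma isGLB_avgSet (hω : IsModulus ω) (hN : IsNorm N) (x : Fin d → ℝ) :
    IsGLB (avgSet N ω x) (sInf (avgSet N ω x)) :=
  Real.isGLB_sInf ⟨_, x, 1, one_pos, by simp [hN.map_zero], rfl⟩ (hω.bddBelow_avgSet hN x)

lemma sInf_avgSet_nonneg (hω : IsModulus ω) (hN : IsNorm N) (x : Fin d → ℝ) :
    0 ≤ sInf (avgSet N ω x) := by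
  refine (hω.isGLB_avgSet hN x).2 ?_
  rintro _ ⟨c, R, -, -, rfl⟩
  exact hω.ballAvg_nonneg hN c R

lemma sInf_avgSet_zero (hω : IsModulus ω) (hN : IsNorm N) : sInf (avgSet N ω 0) = 0 := by
  refine le_antisymm (le_of_forall_pos_le_add fun ε hε => ?_) (hω.sInf_avgSet_nonneg hN 0)
  obtain ⟨δ, hδ, h⟩ := Metric.continuousWithinAt_iff.1 (hω.cont 0 self_mem_Ici) ε hε
  have hsmall : ω (δ / 2) ≤ ε := by
    have := h (x := δ / 2) (half_pos hδ).le
      (by rw [Real.dist_eq, sub_zero, abs_of_pos (half_pos hδ)]; linarith)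
    rw [Real.dist_eq, hω.map_zero, sub_zero] at this
    exact (le_abs_self _).trans this.le
  refine (hω.isGLB_avgSet hN 0).1
    ⟨0, δ / 2, half_pos hδ, by simpa [hN.map_zero] using (half_pos hδ).le, rfl⟩ |>.trans ?_
  rw [zero_add]
  refine hω.ballAvg_le hN fun u hu => (hω.mono (hN.nonneg _) (half_pos hδ).le ?_).trans hsmall
  have hu' : N u ≤ 1 := by simpa [nball] using hu
  rw [zero_add, hN.smul_of_nonneg (half_pos hδ).le]
  exact mul_le_of_le_one_right (half_pos hδ).le hu'

lemma sInf_avgSet_add_le (hω : IsModulus ω) (hN : IsNorm N) (x y : Fin d → ℝ) :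
    sInf (avgSet N ω (x + y)) ≤ sInf (avgSet N ω x) + sInf (avgSet N ω y) := by
  rw [← sub_le_iff_le_add]
  refine (hω.isGLB_avgSet hN x).2 ?_
  rintro _ ⟨c, R, hR, hc, rfl⟩
  rw [sub_le_comm]
  refine (hω.isGLB_avgSet hN y).2 ?_
  rintro _ ⟨c', R', hR', hc', rfl⟩
  rw [sub_le_iff_le_add']
  refine ((hω.isGLB_avgSet hN (x + y)).1 ⟨c + c', R + R', add_pos hR hR', ?_, rfl⟩).trans
    (hω.ballAvg_add_le hN c c' R R')
  rw [add_sub_add_comm]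
  exact (hN.add_le _ _).trans (add_le_add hc hc')

lemma sInf_avgSet_smul_mono (hω : IsModulus ω) (hN : IsNorm N) {s t : ℝ} (hs : 0 < s)
    (hst : s ≤ t) (v : Fin d → ℝ) :
    sInf (avgSet N ω (s • v)) ≤ sInf (avgSet N ω (t • v)) := by
  have ht := hs.trans_le hst
  refine (hω.isGLB_avgSet hN _).2 ?_
  rintro _ ⟨c, R, hR, hc, rfl⟩
  have hr : 0 < s / t := div_pos hs ht
  refine ((hω.isGLB_avgSet hN _).1 ⟨(s / t) • c, s / t * R, mul_pos hr hR, ?_, rfl⟩).trans ?_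
  · have : s • v - (s / t) • c = (s / t) • (t • v - c) := by
      rw [smul_sub, smul_smul, div_mul_cancel₀ _ ht.ne']
    rw [this, hN.smul_of_nonneg hr.le]
    exact mul_le_mul_of_nonneg_left hc hr.le
  · refine div_le_div_of_nonneg_right (integral_mono (hω.integrableOn_unitBall hN _ _)
      (hω.integrableOn_unitBall hN _ _) fun u => hω.mono (hN.nonneg _) (hN.nonneg _) ?_)
      ENNReal.toReal_nonneg
    rw [mul_smul, ← smul_add, hN.smul_of_nonneg hr.le]
    exact mul_le_of_le_one_left (hN.nonneg _) ((div_le_one ht).2 hst)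

lemma abs_sub_le (hω : IsModulus ω) (hN : IsNorm N) {t : ℝ} {x y : Fin d → ℝ}
    (hxy : N (x - y) ≤ t) : |ω (N x) - ω (N y)| ≤ ω t := by
  have key : ∀ x y : Fin d → ℝ, N (x - y) ≤ t → ω (N x) ≤ ω t + ω (N y) := fun x y h => by
    have ht : 0 ≤ t := (hN.nonneg _).trans h
    have hle : N x ≤ t + N y := by
      have := hN.add_le (x - y) y
      rw [sub_add_cancel] at this
      linarith
    exact (hω.mono (hN.nonneg _) (add_nonneg ht (hN.nonneg _)) hle).trans
      (hω.subadd _ _ ht (hN.nonneg _))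
  have h1 := key x y hxy
  have h2 := key y x (hN.sub_comm x y ▸ hxy)
  rw [abs_le]
  constructor <;> linarith

lemma maxFn_const_sub (hω : IsModulus ω) (hN : IsNorm N) {Ω : ℝ}
    (hΩ : ∀ s, 0 ≤ s → ω s ≤ Ω) (x : Fin d → ℝ) :
    maxFn N (fun y => Ω - ω (N y)) x = Ω - sInf (avgSet N ω x) := by
  have havg : ∀ c : Fin d → ℝ, ∀ R : ℝ, 0 < R →
      ⨍ y in nball N c R, |Ω - ω (N y)| = Ω - ballAvg N ω c R := fun c R hR => by
    have habs : ∀ y, |Ω - ω (N y)| = Ω - ω (N y) := fun y =>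
      abs_of_nonneg (sub_nonneg.2 (hΩ _ (hN.nonneg y)))
    simp_rw [habs]
    have hconst : IntegrableOn (fun _ => Ω) (nball N 0 1) :=
      integrableOn_const (hN.isCompact_nball 0 1).measure_lt_top.ne
    rw [hN.setAverage_nball _ c hR, integral_sub hconst (hω.integrableOn_unitBall hN c R), setIntegral_const, sub_div, smul_eq_mul, Measure.real,
      mul_div_cancel_left₀ _ hN.volume_unitBall_pos.ne', ballAvg]
  have hglb := hω.isGLB_avgSet hN x
  refine IsLUB.csSup_eq ⟨?_, fun b hb => ?_⟩
    ⟨_, x, 1, one_pos, by simp [nball, hN.map_zero], rfl⟩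
  · rintro _ ⟨c, R, hR, hx, rfl⟩
    rw [havg c R hR]
    exact sub_le_sub_left (hglb.1 ⟨c, R, hR, hx, rfl⟩) _
  · rw [sub_le_comm]
    refine hglb.2 ?_
    rintro _ ⟨c, R, hR, hx, rfl⟩
    rw [sub_le_comm, ← havg c R hR]
    exact hb ⟨c, R, hR, hx, rfl⟩

end IsModulus

lemma IsNorm.setOf_scaled_ballAvg_eq {d : ℕ} {N : (Fin d → ℝ) → ℝ} (hN : IsNorm N)
    (ω : ℝ → ℝ) {t : ℝ} (ht : 0 < t) (v : Fin d → ℝ) :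
    {b : ℝ | ∃ c : Fin d → ℝ, ∃ R : ℝ, 0 < R ∧ N (v - c) ≤ R ∧
      b = (∫ u in nball N 0 1, ω (t * N (c + R • u))) / (volume (nball N 0 1)).toReal} =
    avgSet N ω (t • v) := by
  have hscale : ∀ (c : Fin d → ℝ) (R : ℝ),
      (∫ u in nball N 0 1, ω (t * N (c + R • u))) / (volume (nball N 0 1)).toReal =
        ballAvg N ω (t • c) (t * R) := fun c R => by
    simp_rw [ballAvg, mul_smul, ← smul_add, hN.smul_of_nonneg ht.le]
  ext b
  constructor
  · rintro ⟨c, R, hR, hc, rfl⟩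
    refine ⟨t • c, t * R, mul_pos ht hR, ?_, hscale c R⟩
    rw [← smul_sub, hN.smul_of_nonneg ht.le]
    exact mul_le_mul_of_nonneg_left hc ht.le
  · rintro ⟨c, R, hR, hc, rfl⟩
    refine ⟨t⁻¹ • c, t⁻¹ * R, mul_pos (inv_pos.2 ht) hR, ?_, ?_⟩
    · have : v - t⁻¹ • c = t⁻¹ • (t • v - c) := by
        rw [smul_sub, inv_smul_smul₀ ht.ne']
      rw [this, hN.smul_of_nonneg (inv_pos.2 ht).le]
      exact mul_le_mul_of_nonneg_left hc (inv_pos.2 ht).le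
    · rw [hscale, smul_inv_smul₀ ht.ne', mul_inv_cancel_left₀ ht.ne']

lemma IsNorm.exists_eq_smul_unit {d : ℕ} {N : (Fin d → ℝ) → ℝ} (hN : IsNorm N)
    {x : Fin d → ℝ} (hx : x ≠ 0) : 0 < N x ∧ ∃ v, N v = 1 ∧ x = N x • v := by
  have hpos : 0 < N x := lt_of_le_of_ne (hN.nonneg x) fun h => hx ((hN.eq_zero_iff x).1 h.symm)
  refine ⟨hpos, (N x)⁻¹ • x, ?_, (smul_inv_smul₀ hpos.ne' x).symm⟩
  rw [hN.smul_of_nonneg (inv_pos.2 hpos).le, inv_mul_cancel₀ hpos.ne']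

/-- For a bounded modulus of continuity `ω`, the extremal function `ψ(x) = Ω − ω(‖x‖)`
has modulus of continuity exactly `ω`, and its maximal function attains equality in the
main integral formula. -/
theorem stmt2 (d : ℕ) (hd : 1 ≤ d) (N : (Fin d → ℝ) → ℝ) (hN : IsNorm N)
    (ω : ℝ → ℝ) (hω : IsModulus ω) (hbdd : BddAbove (ω '' Set.Ici 0))
    (Ω : ℝ) (hΩ : Ω = sSup (ω '' Set.Ici 0))
    (ψ : (Fin d → ℝ) → ℝ) (hψ : ψ = fun x => Ω - ω (N x))
    (t : ℝ) (ht : 0 < t) :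
    modCont N ψ t = ω t ∧
    modCont N (maxFn N ψ) t =
      sSup {a : ℝ | ∃ v : Fin d → ℝ, N v = 1 ∧
        a = sInf {b : ℝ | ∃ c : Fin d → ℝ, ∃ R : ℝ, 0 < R ∧ N (v - c) ≤ R ∧
          b = (∫ u in nball N 0 1, ω (t * N (c + R • u))) /
                (volume (nball N 0 1)).toReal}} := by
  have hle : ∀ s, 0 ≤ s → ω s ≤ Ω := fun s hs => by
    rw [hΩ]
    exact le_csSup hbdd ⟨s, hs, rfl⟩
  have hone : (fun _ => 1 : Fin d → ℝ) ≠ 0 := fun h => one_ne_zero (congrFun h ⟨0, hd⟩)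
  obtain ⟨-, e, he, -⟩ := hN.exists_eq_smul_unit hone
  subst hψ
  constructor
  · refine IsGreatest.csSup_eq ⟨⟨t • e, 0, ?_, ?_⟩, ?_⟩
    · rw [sub_zero, hN.smul_of_nonneg ht.le, he, mul_one]
    · beta_reduce
      rw [hN.smul_of_nonneg ht.le, he, mul_one, hN.map_zero, hω.map_zero, sub_zero,
        sub_sub_cancel_left, abs_neg, abs_of_nonneg (hω.nonneg t ht.le)]
    · rintro _ ⟨x, y, hxy, rfl⟩
      rw [sub_sub_sub_cancel_left, abs_sub_comm]
      exact hω.abs_sub_le hN hxy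
  simp_rw [hN.setOf_scaled_ballAvg_eq ω ht]
  have hbddS : BddAbove {a | ∃ v, N v = 1 ∧ a = sInf (avgSet N ω (t • v))} := by
    refine ⟨Ω, ?_⟩
    rintro _ ⟨v, -, rfl⟩
    exact ((hω.isGLB_avgSet hN _).1
      ⟨t • v, 1, one_pos, by simp [hN.map_zero], rfl⟩).trans
        (hω.ballAvg_le hN fun u _ => hle _ (hN.nonneg _))
  have hinc : ∀ x y : Fin d → ℝ, N (x - y) ≤ t →
      sInf (avgSet N ω x) - sInf (avgSet N ω y) ≤
        sSup {a | ∃ v, N v = 1 ∧ a = sInf (avgSet N ω (t • v))} := fun x y hxy => by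
    rcases eq_or_ne x y with rfl | hne
    · rw [sub_self]
      exact (hω.sInf_avgSet_nonneg hN (t • e)).trans (le_csSup hbddS ⟨e, he, rfl⟩)
    obtain ⟨hpos, v, hv, hxv⟩ := hN.exists_eq_smul_unit (sub_ne_zero.2 hne)
    have hadd := hω.sInf_avgSet_add_le hN (x - y) y
    rw [sub_add_cancel] at hadd
    have hmono := hω.sInf_avgSet_smul_mono hN hpos hxy v
    rw [← hxv] at hmono
    have := le_csSup hbddS ⟨v, hv, rfl⟩
    linarith
  have hupper : ∀ a ∈ {a : ℝ | ∃ x y : Fin d → ℝ, N (x - y) ≤ t ∧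
      a = |maxFn N (fun x => Ω - ω (N x)) x - maxFn N (fun x => Ω - ω (N x)) y|},
      a ≤ sSup {a | ∃ v, N v = 1 ∧ a = sInf (avgSet N ω (t • v))} := by
    rintro _ ⟨x, y, hxy, rfl⟩
    rw [hω.maxFn_const_sub hN hle, hω.maxFn_const_sub hN hle, sub_sub_sub_cancel_left]
    exact abs_sub_le_iff.2 ⟨hinc y x (hN.sub_comm x y ▸ hxy), hinc x y hxy⟩
  refine le_antisymm (csSup_le ⟨_, 0, 0, by simp [hN.map_zero, ht.le], rfl⟩ hupper)
    (csSup_le ⟨_, e, he, rfl⟩ ?_)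
  rintro _ ⟨v, hv, rfl⟩
  refine le_csSup ⟨_, hupper⟩ ⟨t • v, 0, ?_, ?_⟩
  · rw [sub_zero, hN.smul_of_nonneg ht.le, hv, mul_one]
  · rw [hω.maxFn_const_sub hN hle, hω.maxFn_const_sub hN hle, sub_sub_sub_cancel_left,
      hω.sInf_avgSet_zero hN, zero_sub, abs_neg, abs_of_nonneg (hω.sInf_avgSet_nonneg hN _)]
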